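/- Assume the generator is human-aligned. Then for every α ∈ (0,1), the probability mass of the intersection of the portfolio with the human portfolio satisfies ∑_{o ∈ P(α) ∩ P*(α)} p(o) ≥ 1 − 2α. -/

import Mathlib

open Finset

/-- The top-`k` set of a ranking `r` of a finite type `O`: the candidates whose
rank (position under `r`) is among the first `k`. -/
def topk {O : Type*} [Fintype O] [DecidableEq O]
    (r : Fin (Fintype.card O) ≃ O) (k : ℕ) : Finset O :=
  Finset.univ.filter (fun o => ((r.symm o : Fin (Fintype.card O)) : ℕ) < k)

/-- `kstar p r α` is the least `k ≥ 1` such that the probability mass of the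
top-`k` set of the ranking `r` is at least `1 - α`. -/
noncomputable def kstar {O : Type*} [Fintype O] [DecidableEq O]
    (p : O → ℝ) (r : Fin (Fintype.card O) ≃ O) (α : ℝ) : ℕ :=
  sInf {k : ℕ | 1 ≤ k ∧ (1 - α) ≤ ∑ o ∈ topk r k, p o}

/-- Among finite sets of a given size, the total weight is largest on a set whose members all
weigh at least as much as the non-members. -/
lemma sum_le_sum_of_card_eq_of_dominates {O : Type*} [DecidableEq O] {p : O → ℝ} {S T : Finset O}
    (hcard : T.card = S.card) (hdom : ∀ x ∈ S, ∀ y ∉ S, p y ≤ p x) :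
    ∑ o ∈ T, p o ≤ ∑ o ∈ S, p o := by
  have hc : (T \ S).card = (S \ T).card := Finset.card_sdiff_comm hcard
  rw [← Finset.sum_sdiff_le_sum_sdiff]
  rcases (S \ T).eq_empty_or_nonempty with hST | hST
  · have hTS : T \ S = ∅ := by
      rw [← Finset.card_eq_zero, hc, hST, Finset.card_empty]
    simp [hST, hTS]
  · obtain ⟨m, hm, hmin⟩ := Finset.exists_min_image _ p hST
    calc ∑ o ∈ T \ S, p o ≤ (T \ S).card • p m :=
          Finset.sum_le_card_nsmul _ _ _ fun y hy =>
            hdom m (Finset.mem_sdiff.1 hm).1 y (Finset.mem_sdiff.1 hy).2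
      _ = (S \ T).card • p m := by rw [hc]
      _ ≤ ∑ o ∈ S \ T, p o := Finset.card_nsmul_le_sum _ _ _ hmin

lemma card_topk_eq_card_topk {O : Type*} [Fintype O] [DecidableEq O]
    (r s : Fin (Fintype.card O) ≃ O) (k : ℕ) : (topk r k).card = (topk s k).card :=
  Finset.card_equiv (r.symm.trans s) (by simp [topk])

lemma topk_card {O : Type*} [Fintype O] [DecidableEq O] (r : Fin (Fintype.card O) ≃ O) :
    topk r (Fintype.card O) = Finset.univ := by
  simp [topk]

lemma one_sub_le_sum_topk_kstar {O : Type*} [Fintype O] [DecidableEq O] [Nonempty O]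
    {p : O → ℝ} (hsum : ∑ o, p o = 1) (r : Fin (Fintype.card O) ≃ O) {α : ℝ} (hα : 0 ≤ α) :
    1 - α ≤ ∑ o ∈ topk r (kstar p r α), p o :=
  (Nat.sInf_mem (s := {k : ℕ | 1 ≤ k ∧ 1 - α ≤ ∑ o ∈ topk r k, p o})
    ⟨Fintype.card O, Fintype.card_pos, by rw [topk_card, hsum]; linarith⟩).2

/-- The top-`k` set of a ranking by decreasing weight is the heaviest among all top-`k` sets. -/
lemma sum_topk_le_sum_topk_of_antitone {O : Type*} [Fintype O] [DecidableEq O] {p : O → ℝ}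
    (e h : Fin (Fintype.card O) ≃ O)
    (halign : ∀ i j : Fin (Fintype.card O), i ≤ j → p (h j) ≤ p (h i)) (k : ℕ) :
    ∑ o ∈ topk e k, p o ≤ ∑ o ∈ topk h k, p o := by
  refine sum_le_sum_of_card_eq_of_dominates (card_topk_eq_card_topk e h k) fun x hx y hy => ?_
  simp only [topk, Finset.mem_filter, Finset.mem_univ, true_and, not_lt] at hx hy
  simpa using halign (h.symm x) (h.symm y) (Fin.le_def.2 (hx.le.trans hy))

/-- If the generator is human-aligned, then for every α ∈ (0,1), the probability
mass of P(α) ∩ P*(α) is at least 1 - 2α. -/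
theorem mass_inter_ge_one_sub_two_alpha
    (O : Type*) [Fintype O] [DecidableEq O] [Nonempty O]
    (p : O → ℝ) (hp : ∀ o, 0 ≤ p o) (hsum : ∑ o, p o = 1)
    (e h : Fin (Fintype.card O) ≃ O)
    (halign : ∀ i j : Fin (Fintype.card O), i ≤ j → p (h j) ≤ p (h i))
    (α : ℝ) (hα0 : 0 < α) (hα1 : α < 1) :
    (1 - 2 * α) ≤ ∑ o ∈ topk e (kstar p e α) ∩ topk h (kstar p e α), p o := by
  have hE := one_sub_le_sum_topk_kstar hsum e hα0.le
  have hEH := sum_topk_le_sum_topk_of_antitone e h halign (kstar p e α)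
  have hinter := Finset.sum_union_inter (s₁ := topk e (kstar p e α))
    (s₂ := topk h (kstar p e α)) (f := p)
  have hunion : ∑ o ∈ topk e (kstar p e α) ∪ topk h (kstar p e α), p o ≤ 1 :=
    hsum ▸ Finset.sum_le_univ_sum_of_nonneg hp
  linarith
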